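/- In every execution of Algorithm A_k in which both processes decide, the numbers of loop iterations performed satisfy |r_1 − r_2| ≤ 1. -/

import Mathlib

/-!
Operational semantics of the two-process 1-bit-register approximate-agreement
protocol `A_k` (Algorithm 1 of the paper).

The two processes are indexed by `Fin 2`.  Shared memory consists of two 1-bit
registers `R 0, R 1` (initialized to `false`, i.e. `0`; only process `i` writes
`R i`) and two write-once input registers `I 0, I 1` (initialized to `⊥ = none`).
Each read or write of a single register is one atomic step.  An execution is
determined by the inputs `x : Fin 2 → Bool` together with a schedule
`sched : ℕ → Fin 2` telling which process takes the next step (a step of a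
process that has already decided is a no-op; a process crashes by being
scheduled only finitely often).
-/

namespace AlgoAk

/-- The other process. -/
def other (i : Fin 2) : Fin 2 := if i = 0 then 1 else 0

/-- The value (0 or 1) as a rational. -/
def bq (b : Bool) : ℚ := if b then 1 else 0

/-- Program counter of a process:
`start` = about to write its input to its input register;
`loopW` = about to perform the write of the current for-loop iteration;
`loopR` = about to perform the read of the current for-loop iteration;
`readMine` = left the for-loop, about to read its own input register;
`readOther` = about to read the other input register (and then decide);
`done` = has decided. -/
inductive PC where
  | start | loopW | loopR | readMine | readOther | done
deriving DecidableEq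

/-- Local state of a process: program counter, loop variable `r`, local
variables `prec` and `new`, the value read from the other input register,
and the output (once decided). -/
structure PState where
  pc : PC
  r : ℕ
  prec : Bool
  new : Bool
  xother : Option Bool
  out : Option ℚ

/-- Global configuration: local states, the two 1-bit registers, and the two
write-once input registers. -/
structure Config where
  p : Fin 2 → PState
  R : Fin 2 → Bool
  I : Fin 2 → Option Bool

/-- Initial local state. -/
def initP : PState := ⟨PC.start, 1, false, false, none, none⟩

/-- Initial configuration. -/
def initC : Config := ⟨fun _ => initP, fun _ => false, fun _ => none⟩

/-- Update the local state of process `i`. -/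
def updP (c : Config) (i : Fin 2) (s : PState) : Config :=
  { c with p := Function.update c.p i s }

/-- The decision function of the protocol, computed from the process' own input
`xme`, the value `xother` read from the other input register, and the values
`r` and `new` of the local variables when the for-loop was left. -/
def decideVal (k : ℕ) (xme : Bool) (xother : Option Bool) (r : ℕ) (new : Bool) : ℚ :=
  match xother with
  | none => bq xme
  | some xo =>
    if xme = xo then bq xme
    else if r = k ∧ new = decide (k % 2 = 1) then
      -- normal termination after k iterations
      let xwho := if r % 2 = 0 then xme else xo
      (bq xwho + (k : ℚ)) / (2 * (k : ℚ) + 1)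
    else
      -- left the loop via a break at iteration r
      let xwho := if r % 2 = 0 then xo else xme
      bq xwho + ((-1 : ℚ) ^ (if xwho then 1 else 0) * ((r : ℚ) - 1)) / (2 * (k : ℚ) + 1)

/-- One atomic step of process `i` in configuration `c`. -/
def step (k : ℕ) (x : Fin 2 → Bool) (c : Config) (i : Fin 2) : Config :=
  let s := c.p i
  match s.pc with
  | PC.start =>
      let c' := updP c i { s with pc := PC.loopW }
      { c' with I := Function.update c'.I i (some (x i)) }
  | PC.loopW =>
      let c' := updP c i { s with pc := PC.loopR }
      { c' with R := Function.update c'.R i (decide (s.r % 2 = 1)) }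
  | PC.loopR =>
      let nv := c.R (other i)
      if nv ≠ s.prec then
        if s.r < k then
          updP c i { s with pc := PC.loopW, r := s.r + 1, prec := nv, new := nv }
        else
          updP c i { s with pc := PC.readMine, prec := nv, new := nv }
      else
        updP c i { s with pc := PC.readMine, new := nv }
  | PC.readMine =>
      updP c i { s with pc := PC.readOther }
  | PC.readOther =>
      let xo := c.I (other i)
      updP c i { s with pc := PC.done, xother := xo,
                        out := some (decideVal k (x i) xo s.r s.new) }
  | PC.done => c

/-- The configuration after `n` steps of the execution of `A_k` with inputs `x`
and schedule `sched`. -/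
def run (k : ℕ) (x : Fin 2 → Bool) (sched : ℕ → Fin 2) : ℕ → Config
  | 0 => initC
  | n + 1 => step k x (run k x sched n) (sched n)

end AlgoAk

namespace AlgoAk

/-- The number of writes to its 1-bit register that a process has performed in the loop. -/
def PState.writes (s : PState) : ℕ :=
  if s.pc = PC.start ∨ s.pc = PC.loopW then s.r - 1 else s.r

/-- The part of the loop invariant concerning process `i`: its register holds the parity of its
write count, which exceeds that of the other process by at most one, even after a pending write. -/
structure LoopInv (c : Config) (i : Fin 2) : Prop where
  one_le_r : 1 ≤ (c.p i).r
  r_start : (c.p i).pc = PC.start → (c.p i).r = 1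
  prec_eq : (c.p i).pc = PC.start ∨ (c.p i).pc = PC.loopW ∨ (c.p i).pc = PC.loopR →
    (c.p i).prec = decide (((c.p i).r - 1) % 2 = 1)
  reg_eq : c.R i = decide ((c.p i).writes % 2 = 1)
  pending : (c.p i).pc = PC.loopW → (c.p i).r ≤ (c.p (other i)).writes + 1
  writes_le : (c.p i).writes ≤ (c.p (other i)).writes + 1

theorem other_other (i : Fin 2) : other (other i) = i := by
  fin_cases i <;> rfl

theorem other_ne (i : Fin 2) : other i ≠ i := by
  fin_cases i <;> simp [other]

theorem eq_or_eq_other (i j : Fin 2) : i = j ∨ i = other j := by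
  fin_cases i <;> fin_cases j <;> simp [other]

theorem loopInv_step (k : ℕ) (x : Fin 2 → Bool) (c : Config) (j : Fin 2)
    (h : ∀ i, LoopInv c i) (i : Fin 2) : LoopInv (step k x c j) i := by
  by_cases hd : (c.p j).pc = PC.done
  · simpa only [step, hd] using h i
  obtain ⟨a1, a2, a3, a4, a5, a6⟩ := h j
  obtain ⟨b1, b2, b3, b4, b5, b6⟩ := h (other j)
  rw [other_other] at b5 b6
  have hne := other_ne j
  cases hpc : (c.p j).pc <;>
    first
    | exact absurd hpc hd
    | simp only [hpc, PState.writes, step, reduceCtorEq, or_false, or_true, if_true, if_false,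
        forall_const] at * <;>
      (try split_ifs) <;>
      rcases eq_or_eq_other i j with rfl | rfl <;>
      constructor <;>
      simp only [updP, PState.writes, other_other, Function.update_self, ne_eq, hne,
        not_false_eq_true, Function.update_of_ne] <;>
      grind

theorem loopInv_run (k : ℕ) (x : Fin 2 → Bool) (sched : ℕ → Fin 2) (n : ℕ) :
    ∀ i, LoopInv (run k x sched n) i := by
  induction n with
  | zero => intro i; constructor <;> simp [run, initC, initP, PState.writes]
  | succ n ih => exact loopInv_step k x _ _ ih

theorem step_p_of_done {k : ℕ} {x : Fin 2 → Bool} {c : Config} {i : Fin 2} (j : Fin 2)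
    (h : (c.p i).pc = PC.done) : (step k x c j).p i = c.p i := by
  by_cases hij : i = j
  · subst hij
    simp [step, h]
  · simp only [step]
    split <;> (try split_ifs) <;> simp [updP, hij]

theorem run_p_of_done {k : ℕ} {x : Fin 2 → Bool} {sched : ℕ → Fin 2} {i : Fin 2} {m n : ℕ}
    (hmn : m ≤ n) (h : ((run k x sched m).p i).pc = PC.done) :
    (run k x sched n).p i = (run k x sched m).p i := by
  induction n, hmn using Nat.le_induction with
  | base => rfl
  | succ n _ ih => rw [run, step_p_of_done _ (by rwa [ih]), ih]

end AlgoAk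

open AlgoAk in
/-- Lemma 7: in every execution of `A_k` in which both processes decide, the
numbers `r₁, r₂` of for-loop iterations they performed satisfy `|r₁ − r₂| ≤ 1`.
(The `r` field of a process' local state is unchanged after it leaves its
for-loop, so it can be read off any configuration in which the process is done.) -/
theorem iterations_within_one (k : ℕ) (hk : 1 ≤ k) (x : Fin 2 → Bool)
    (sched : ℕ → Fin 2) (n₁ n₂ : ℕ)
    (h1 : ((run k x sched n₁).p 0).pc = PC.done)
    (h2 : ((run k x sched n₂).p 1).pc = PC.done) :
    |(((run k x sched n₁).p 0).r : ℤ) - (((run k x sched n₂).p 1).r : ℤ)| ≤ 1 := by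
  have e1 := run_p_of_done (le_max_left n₁ n₂) h1
  have e2 := run_p_of_done (le_max_right n₁ n₂) h2
  have i1 := (loopInv_run k x sched (max n₁ n₂) 0).writes_le
  have i2 := (loopInv_run k x sched (max n₁ n₂) 1).writes_le
  simp only [other, if_true, one_ne_zero, if_false, e1, e2, PState.writes, h1, h2, reduceCtorEq,
    or_self] at i1 i2
  rw [abs_le]
  omega
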